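/- Let K ⊂ (-1,0) be a compact set. Then R_n converges to the constant function 1 uniformly on K; that is, sup_{q ∈ K} |R_n(q) - 1| → 0 as n → ∞. -/

import Mathlib

open SimpleGraph Finset

noncomputable section

/-- The finset of edges of a simple graph on a finite vertex type. -/
def edgeFin {V : Type} [Finite V] (G : SimpleGraph V) : Finset (Sym2 V) :=
  (Set.toFinite G.edgeSet).toFinset

open Classical in
/-- All-terminal reliability polynomial: `relPoly G q` is the probability that the graph stays
connected when every edge fails independently with probability `q`. -/
def relPoly {V : Type} [Finite V] (G : SimpleGraph V) (q : ℝ) : ℝ :=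
  ∑ A ∈ (edgeFin G).powerset,
    if (SimpleGraph.fromEdgeSet (A : Set (Sym2 V))).Connected then
      (1 - q) ^ A.card * q ^ ((edgeFin G).card - A.card) else 0

open Classical in
/-- Split reliability polynomial with terminals `u`, `v`: the sum is over edge subsets whose
spanning subgraph has exactly two components, one containing `u` and the other containing `v`. -/
def splitRel {V : Type} [Finite V] (H : SimpleGraph V) (u v : V) (q : ℝ) : ℝ :=
  ∑ A ∈ (edgeFin H).powerset,
    if (¬ (SimpleGraph.fromEdgeSet (A : Set (Sym2 V))).Reachable u v ∧
        ∀ w, (SimpleGraph.fromEdgeSet (A : Set (Sym2 V))).Reachable u w ∨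
             (SimpleGraph.fromEdgeSet (A : Set (Sym2 V))).Reachable v w) then
      (1 - q) ^ A.card * q ^ ((edgeFin H).card - A.card) else 0

/-- The virtual edge interaction `ŷ_H = Rel(H)/S(H) + 1`. -/
def yhat {V : Type} [Finite V] (H : SimpleGraph V) (u v : V) (q : ℝ) : ℝ :=
  relPoly H q / splitRel H u v q + 1

/-- `Hgraph n` is the complete graph on `Fin n` with the edge between `0` and `1` removed
(for `n ≥ 2`; for `n < 2` no edge is removed). -/
def Hgraph (n : ℕ) : SimpleGraph (Fin n) :=
  (⊤ : SimpleGraph (Fin n)).deleteEdges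
    {e | ∃ _h : 2 ≤ n, e = s(⟨0, by omega⟩, ⟨1, by omega⟩)}

/-- `Cfun n q = Rel(K_n; q)`. -/
def Cfun (n : ℕ) (q : ℝ) : ℝ := relPoly (⊤ : SimpleGraph (Fin n)) q

/-- `Rfun n q = Rel(H_n; q)` where `H_n = K_n` minus an edge. -/
def Rfun (n : ℕ) (q : ℝ) : ℝ := relPoly (Hgraph n) q

/-- `Sfun n q = S(H_n; q)`, the split reliability of `K_n` minus the edge `uv`,
with terminals `u`, `v` the endpoints of the deleted edge. -/
def Sfun (n : ℕ) (q : ℝ) : ℝ :=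
  if h : 2 ≤ n then splitRel (Hgraph n) ⟨0, by omega⟩ ⟨1, by omega⟩ q else 0

/-- `yfun n q = ŷ_{H_n}(q)`. -/
def yfun (n : ℕ) (q : ℝ) : ℝ := Rfun n q / Sfun n q + 1

/-- Sums over the subsets of a disjoint union factor when the summand does. -/
lemma sum_powerset_union_mul {α : Type} [DecidableEq α] (q : ℝ) {E F : Finset α} (h : Disjoint E F)
    (f g : Finset α → ℝ) :
    ∑ A ∈ (E ∪ F).powerset,
        f (A ∩ E) * g (A ∩ F) * ((1 - q) ^ A.card * q ^ ((E ∪ F).card - A.card)) =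
      (∑ A ∈ E.powerset, f A * ((1 - q) ^ A.card * q ^ (E.card - A.card))) *
        ∑ A ∈ F.powerset, g A * ((1 - q) ^ A.card * q ^ (F.card - A.card)) := by
  rw [Finset.sum_mul_sum, ← Finset.sum_product']
  symm
  refine Finset.sum_bij' (fun p _ => p.1 ∪ p.2) (fun A _ => (A ∩ E, A ∩ F)) ?_ ?_ ?_ ?_ ?_
  · rintro ⟨A, B⟩ hp
    simp only [mem_product, mem_powerset] at hp ⊢
    exact Finset.union_subset_union hp.1 hp.2
  · intro A hA
    simp
  · rintro ⟨A, B⟩ hp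
    simp only [mem_product, mem_powerset] at hp
    rw [Finset.disjoint_left] at h
    ext x <;> simp <;> grind
  · intro A hA
    rw [mem_powerset] at hA
    rw [← Finset.inter_union_distrib_left, Finset.inter_eq_left.2 hA]
  · rintro ⟨A, B⟩ hp
    simp only [mem_product, mem_powerset] at hp
    obtain ⟨hA, hB⟩ := hp
    have hAE : (A ∪ B) ∩ E = A := by
      rw [Finset.disjoint_left] at h
      ext x; simp; grind
    have hBF : (A ∪ B) ∩ F = B := by
      rw [Finset.disjoint_left] at h
      ext x; simp; grind
    have hAB : Disjoint A B := h.mono hA hB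
    have h1 := card_le_card hA
    have h2 := card_le_card hB
    simp only [hAE, hBF]
    rw [card_union_of_disjoint hAB, card_union_of_disjoint h,
      show E.card + F.card - (A.card + B.card) = (E.card - A.card) + (F.card - B.card) by omega,
      pow_add, pow_add]
    ring

/-- The edge of the ambient graph corresponding to an edge between elements of `S`. -/
def sym2Val {V : Type} (S : Set V) : Sym2 S ↪ Sym2 V :=
  ⟨Sym2.map Subtype.val, Sym2.map.injective Subtype.val_injective⟩

lemma mk_mem_map_sym2Val {V : Type} {S : Set V} (B : Finset (Sym2 S)) (x y : V) :
    s(x, y) ∈ B.map (sym2Val S) ↔ ∃ (hx : x ∈ S) (hy : y ∈ S), s(⟨x, hx⟩, ⟨y, hy⟩) ∈ B := by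
  constructor
  · intro h
    obtain ⟨e, he, hxy⟩ := Finset.mem_map.1 h
    induction e using Sym2.ind with
    | _ a b =>
      have hxy' : s((a : V), (b : V)) = s(x, y) := hxy
      rcases Sym2.eq_iff.1 hxy' with ⟨rfl, rfl⟩ | ⟨rfl, rfl⟩
      · exact ⟨a.2, b.2, he⟩
      · exact ⟨b.2, a.2, by rwa [Sym2.eq_swap]⟩
  · rintro ⟨hx, hy, h⟩
    exact Finset.mem_map.2 ⟨_, h, rfl⟩

lemma connected_iff_reachable_map {V : Type} {S : Set V} (B : Finset (Sym2 S)) {v : V}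
    (hv : v ∈ S) :
    (fromEdgeSet (B : Set (Sym2 S))).Connected ↔
      ∀ w, (fromEdgeSet (B.map (sym2Val S) : Set (Sym2 V))).Reachable v w ↔ w ∈ S := by
  have hadj : ∀ a b : S, (fromEdgeSet (B : Set (Sym2 S))).Adj a b →
      (fromEdgeSet (B.map (sym2Val S) : Set (Sym2 V))).Adj a b := by
    intro a b hab
    rw [fromEdgeSet_adj] at hab ⊢
    refine ⟨?_, fun h => hab.2 (Subtype.ext h)⟩
    rw [Finset.mem_coe, mk_mem_map_sym2Val]
    exact ⟨a.2, b.2, hab.1⟩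
  have hback : ∀ w, (fromEdgeSet (B.map (sym2Val S) : Set (Sym2 V))).Reachable v w →
      ∃ hw : w ∈ S, (fromEdgeSet (B : Set (Sym2 S))).Reachable ⟨v, hv⟩ ⟨w, hw⟩ := by
    intro w hw
    rw [reachable_iff_reflTransGen] at hw
    induction hw with
    | refl => exact ⟨hv, Reachable.refl _⟩
    | tail _ hbc ih =>
      obtain ⟨hb, hr⟩ := ih
      rw [fromEdgeSet_adj, Finset.mem_coe, mk_mem_map_sym2Val] at hbc
      obtain ⟨⟨hb', hc, he⟩, hne⟩ := hbc
      refine ⟨hc, hr.trans (Adj.reachable ?_)⟩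
      rw [fromEdgeSet_adj]
      exact ⟨he, fun h => hne (congrArg Subtype.val h)⟩
  constructor
  · intro hc w
    refine ⟨fun h => (hback w h).1, fun hw => ?_⟩
    exact (hc.preconnected ⟨v, hv⟩ ⟨w, hw⟩).map ⟨Subtype.val, fun {a b} => hadj a b⟩
  · intro h
    rw [connected_iff_exists_forall_reachable]
    exact ⟨⟨v, hv⟩, fun w => (hback w ((h w).2 w.2)).2⟩

lemma mem_edgeFin {V : Type} [Finite V] (G : SimpleGraph V) (x y : V) :
    s(x, y) ∈ edgeFin G ↔ G.Adj x y := by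
  simp [edgeFin]

open Classical in
/-- The edges of `G` with exactly one endpoint in `S`. -/
def edgeBoundary {V : Type} [Finite V] (G : SimpleGraph V) (S : Set V) : Finset (Sym2 V) :=
  (edgeFin G).filter fun e => ∃ x ∈ S, ∃ y ∉ S, e = s(x, y)

open Classical in
lemma mem_edgeBoundary {V : Type} [Finite V] (G : SimpleGraph V) (S : Set V) (x y : V) :
    s(x, y) ∈ edgeBoundary G S ↔ G.Adj x y ∧ (x ∈ S ∧ y ∉ S ∨ y ∈ S ∧ x ∉ S) := by
  rw [edgeBoundary, mem_filter, mem_edgeFin]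
  refine and_congr_right fun _ => ⟨?_, ?_⟩
  · rintro ⟨a, ha, b, hb, h⟩
    rcases Sym2.eq_iff.1 h with ⟨rfl, rfl⟩ | ⟨rfl, rfl⟩
    · exact Or.inl ⟨ha, hb⟩
    · exact Or.inr ⟨ha, hb⟩
  · rintro (⟨hx, hy⟩ | ⟨hy, hx⟩)
    · exact ⟨x, hx, y, hy, rfl⟩
    · exact ⟨y, hy, x, hx, Sym2.eq_swap⟩

open Classical in
lemma relPoly_induce {V : Type} [Finite V] (G : SimpleGraph V) (S : Set V) {v : V} (hv : v ∈ S)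
    (q : ℝ) :
    relPoly (G.induce S) q =
      ∑ A ∈ ((edgeFin (G.induce S)).map (sym2Val S)).powerset,
        (if ∀ w, (fromEdgeSet (A : Set (Sym2 V))).Reachable v w ↔ w ∈ S then (1 : ℝ) else 0) *
          ((1 - q) ^ A.card * q ^ (((edgeFin (G.induce S)).map (sym2Val S)).card - A.card)) := by
  rw [relPoly]
  refine Finset.sum_bij (fun B _ => B.map (sym2Val S)) ?_ ?_ ?_ ?_
  · intro B hB
    rw [mem_powerset] at hB ⊢
    exact Finset.map_subset_map.2 hB
  · intro B _ C _ h
    exact Finset.map_injective _ h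
  · intro A hA
    obtain ⟨B, hB, rfl⟩ := Finset.subset_map_iff.1 (mem_powerset.1 hA)
    exact ⟨B, mem_powerset.2 hB, rfl⟩
  · intro B _
    rw [card_map, card_map, ite_mul, one_mul, zero_mul]
    exact if_congr (connected_iff_reachable_map B hv) rfl rfl

/-- The component of `v` in `A` is `S` iff `A` avoids the boundary of `S` and the edges of `A`
inside `S` connect it. -/
lemma reachable_iff_mem_iff {V : Type} [Finite V] [DecidableEq (Sym2 V)] (G : SimpleGraph V)
    (S : Set V) {v : V} (hv : v ∈ S) {A : Finset (Sym2 V)} (hA : A ⊆ edgeFin G) :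
    (∀ w, (fromEdgeSet (A : Set (Sym2 V))).Reachable v w ↔ w ∈ S) ↔
      A ∩ edgeBoundary G S = ∅ ∧
        ∀ w, (fromEdgeSet ((A ∩ (edgeFin (G.induce S)).map (sym2Val S) : Finset (Sym2 V)) :
          Set (Sym2 V))).Reachable v w ↔ w ∈ S := by
  have hle : fromEdgeSet ((A ∩ (edgeFin (G.induce S)).map (sym2Val S) : Finset (Sym2 V)) :
      Set (Sym2 V)) ≤ fromEdgeSet (A : Set (Sym2 V)) :=
    fromEdgeSet_mono (by exact_mod_cast Finset.inter_subset_left)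
  have hin : ∀ b c, b ∈ S → c ∈ S → (fromEdgeSet (A : Set (Sym2 V))).Adj b c →
      (fromEdgeSet ((A ∩ (edgeFin (G.induce S)).map (sym2Val S) : Finset (Sym2 V)) :
        Set (Sym2 V))).Adj b c := by
    intro b c hb hc hbc
    rw [fromEdgeSet_adj, Finset.mem_coe] at hbc ⊢
    refine ⟨mem_inter.2 ⟨hbc.1, ?_⟩, hbc.2⟩
    rw [mk_mem_map_sym2Val]
    refine ⟨hb, hc, ?_⟩
    rw [mem_edgeFin]
    exact (mem_edgeFin G b c).1 (hA hbc.1)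
  constructor
  · intro h
    refine ⟨?_, fun w => ⟨fun hw => (h w).1 (hw.mono hle), fun hw => ?_⟩⟩
    · rw [Finset.eq_empty_iff_forall_notMem]
      have key : ∀ x y, s(x, y) ∈ A → x ∈ S → y ∈ S := by
        intro x y hxy hx
        have hne : x ≠ y := ((mem_edgeFin G x y).1 (hA hxy)).ne
        exact (h y).1 (((h x).2 hx).trans
          (Adj.reachable ((fromEdgeSet_adj _).2 ⟨hxy, hne⟩)))
      intro e he
      induction e using Sym2.ind with
      | _ x y =>
        rw [mem_inter, mem_edgeBoundary] at he
        rcases he.2.2 with ⟨hx, hy⟩ | ⟨hy, hx⟩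
        · exact hy (key x y he.1 hx)
        · exact hx (key y x (Sym2.eq_swap ▸ he.1) hy)
    · have hw' := (h w).2 hw
      rw [reachable_iff_reflTransGen] at hw'
      clear hw
      induction hw' with
      | refl => exact Reachable.refl _
      | @tail b c hb hbc ih =>
        rw [← reachable_iff_reflTransGen] at hb
        have hbS := (h b).1 hb
        have hcS := (h c).1 (hb.trans hbc.reachable)
        exact ih.trans (hin b c hbS hcS hbc).reachable
  · rintro ⟨hempty, h⟩ w
    refine ⟨fun hw => ?_, fun hw => ((h w).2 hw).mono hle⟩
    rw [reachable_iff_reflTransGen] at hw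
    induction hw with
    | refl => exact hv
    | @tail b c _ hbc ih =>
      by_contra hc
      rw [fromEdgeSet_adj, Finset.mem_coe] at hbc
      have : s(b, c) ∈ A ∩ edgeBoundary G S :=
        mem_inter.2 ⟨hbc.1, (mem_edgeBoundary G S b c).2
          ⟨(mem_edgeFin G b c).1 (hA hbc.1), Or.inl ⟨ih, hc⟩⟩⟩
      rw [hempty] at this
      exact Finset.notMem_empty _ this

open Classical in
lemma sum_component_eq {V : Type} [Finite V] (G : SimpleGraph V) (S : Set V) {v : V} (hv : v ∈ S)
    (q : ℝ) :
    ∑ A ∈ (edgeFin G).powerset,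
        (if ∀ w, (fromEdgeSet (A : Set (Sym2 V))).Reachable v w ↔ w ∈ S then
          (1 - q) ^ A.card * q ^ ((edgeFin G).card - A.card) else 0) =
      relPoly (G.induce S) q * q ^ (edgeBoundary G S).card := by
  set E₁ := (edgeFin (G.induce S)).map (sym2Val S) with hE₁
  set E₂ := edgeBoundary G S with hE₂
  set E₃ := edgeFin G \ (E₁ ∪ E₂) with hE₃
  have h1 : E₁ ⊆ edgeFin G := by
    intro e
    induction e using Sym2.ind with
    | _ x y =>
      rw [hE₁, mk_mem_map_sym2Val]
      rintro ⟨hx, hy, h⟩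
      rw [mem_edgeFin] at h ⊢
      exact h
  have h2 : E₂ ⊆ edgeFin G := by
    intro e he
    exact (mem_filter.1 he).1
  have h12 : Disjoint E₁ E₂ := by
    rw [Finset.disjoint_left]
    intro e
    induction e using Sym2.ind with
    | _ x y =>
      rw [hE₁, hE₂, mk_mem_map_sym2Val, mem_edgeBoundary]
      rintro ⟨hx, hy, -⟩ ⟨-, h⟩
      tauto
  have h23 : Disjoint E₂ E₃ := by
    rw [Finset.disjoint_left]; grind
  have h123 : Disjoint E₁ (E₂ ∪ E₃) := by
    rw [Finset.disjoint_left] at h12 ⊢; grind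
  have hE : edgeFin G = E₁ ∪ (E₂ ∪ E₃) := by
    ext e; have := @h1 e; have := @h2 e; grind
  obtain ⟨g, hg⟩ : ∃ g : Finset (Sym2 V) → ℝ, g = fun A => if A = ∅ then 1 else 0 := ⟨_, rfl⟩
  have hfac := sum_powerset_union_mul q h123
    (fun A => if ∀ w, (fromEdgeSet (A : Set (Sym2 V))).Reachable v w ↔ w ∈ S then (1 : ℝ) else 0)
    (fun A => g (A ∩ E₂) * 1)
  have hfac' := sum_powerset_union_mul q h23 g (fun _ => 1)
  rw [hfac', ← relPoly_induce G S hv] at hfac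
  have hone : ∑ A ∈ E₃.powerset, 1 * ((1 - q) ^ A.card * q ^ (E₃.card - A.card)) = 1 := by
    simp_rw [one_mul]
    rw [Finset.sum_pow_mul_eq_add_pow]
    simp
  have hempty : ∑ A ∈ E₂.powerset, g A *
      ((1 - q) ^ A.card * q ^ (E₂.card - A.card)) = q ^ E₂.card := by
    simp_rw [hg, ite_mul, one_mul, zero_mul]
    rw [Finset.sum_ite_eq' ]
    simp
  rw [hone, hempty, mul_one] at hfac
  rw [← hfac, ← hE]
  refine Finset.sum_congr rfl fun A hA => ?_
  have hiff := reachable_iff_mem_iff G S hv (mem_powerset.1 hA)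
  have hA2 : A ∩ (E₂ ∪ E₃) ∩ E₂ = A ∩ E₂ := by
    ext e; simp
  simp only [hA2]
  rw [if_congr hiff rfl rfl]
  by_cases ha : A ∩ E₂ = ∅ <;> simp [ha, hg, ← hE₁, ← hE₂]

open Classical in
/-- The component of a fixed vertex is some set of vertices, with total probability one. -/
theorem sum_relPoly_induce_eq_one {V : Type} [Fintype V] (G : SimpleGraph V) (v : V) (q : ℝ) :
    ∑ S : Finset V with v ∈ S,
      relPoly (G.induce (S : Set V)) q * q ^ (edgeBoundary G (S : Set V)).card = 1 := by
  have h1 : ∑ A ∈ (edgeFin G).powerset, (1 - q) ^ A.card * q ^ ((edgeFin G).card - A.card) = 1 := by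
    rw [Finset.sum_pow_mul_eq_add_pow]
    simp
  rw [← h1]
  trans ∑ S : Finset V with v ∈ S, ∑ A ∈ (edgeFin G).powerset,
      if ∀ w, (fromEdgeSet (A : Set (Sym2 V))).Reachable v w ↔ w ∈ S then
        (1 - q) ^ A.card * q ^ ((edgeFin G).card - A.card) else 0
  · refine Finset.sum_congr rfl fun S hS => ?_
    convert (sum_component_eq G (S : Set V) (by simpa using hS) q).symm
    exact Finset.mem_coe.symm
  rw [Finset.sum_comm]
  refine Finset.sum_congr rfl fun A _ => ?_
  rw [Finset.sum_eq_single (univ.filter fun w => (fromEdgeSet (A : Set (Sym2 V))).Reachable v w)]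
  · simp
  · intro S _ hS
    rw [if_neg]
    intro h
    apply hS
    ext w
    simp [h w]
  · intro h
    simp at h

lemma relPoly_induce_univ {V : Type} [Finite V] [Nonempty V] (G : SimpleGraph V) (q : ℝ) :
    relPoly (G.induce Set.univ) q * q ^ (edgeBoundary G Set.univ).card = relPoly G q := by
  classical
  obtain ⟨v⟩ := ‹Nonempty V›
  rw [← sum_component_eq G Set.univ (Set.mem_univ v), relPoly]
  refine Finset.sum_congr rfl fun A _ => if_congr ?_ rfl rfl
  rw [connected_iff_exists_forall_reachable]
  constructor
  · intro h
    exact ⟨v, fun w => (h w).2 (Set.mem_univ w)⟩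
  · rintro ⟨u, hu⟩ w
    exact ⟨fun _ => Set.mem_univ w, fun _ => (hu v).symm.trans (hu w)⟩

lemma card_mul_card_compl_le {V : Type} [Fintype V] [DecidableEq V] {G : SimpleGraph V}
    (hG : Gᶜ.edgeSet.Subsingleton) (S : Finset V) :
    S.card * (Fintype.card V - S.card) ≤ (edgeBoundary G (S : Set V)).card + 1 := by
  set P := (S ×ˢ Sᶜ).image fun p => s(p.1, p.2) with hP
  have hcard : P.card = S.card * (Fintype.card V - S.card) := by
    rw [hP, card_image_of_injOn, card_product, card_compl]
    rintro ⟨a, b⟩ hab ⟨c, d⟩ hcd h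
    simp only [coe_product, Set.mem_prod, mem_coe, mem_compl] at hab hcd
    rcases Sym2.eq_iff.1 h with ⟨h1, h2⟩ | ⟨h1, h2⟩
    · exact Prod.ext h1 h2
    · exact absurd ((show a = d from h1) ▸ hab.1) hcd.2
  have hsdiff : (P \ edgeBoundary G (S : Set V)).card ≤ 1 := by
    rw [card_le_one]
    have key : ∀ e ∈ P \ edgeBoundary G (S : Set V), e ∈ Gᶜ.edgeSet := by
      intro e he
      rw [mem_sdiff, hP, mem_image] at he
      obtain ⟨⟨⟨a, b⟩, hab, rfl⟩, hne⟩ := he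
      rw [mem_product, mem_compl] at hab
      rw [mem_edgeBoundary] at hne
      rw [mem_edgeSet, compl_adj]
      refine ⟨fun h => hab.2 (h ▸ hab.1), fun h => hne ⟨h, Or.inl ⟨?_, ?_⟩⟩⟩
      · exact mem_coe.2 hab.1
      · exact fun h => hab.2 (mem_coe.1 h)
    exact fun a ha b hb => hG (key a ha) (key b hb)
  have := card_le_card_sdiff_add_card (s := P) (t := edgeBoundary G (S : Set V))
  omega

lemma compl_induce_edgeSet_subsingleton {V : Type} {G : SimpleGraph V}
    (hG : Gᶜ.edgeSet.Subsingleton) (S : Set V) : (G.induce S)ᶜ.edgeSet.Subsingleton := by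
  have key : ∀ e ∈ (G.induce S)ᶜ.edgeSet, sym2Val S e ∈ Gᶜ.edgeSet := by
    intro e
    induction e using Sym2.ind with
    | _ a b =>
      intro h
      rw [mem_edgeSet, compl_adj] at h
      change s((a : V), (b : V)) ∈ Gᶜ.edgeSet
      rw [mem_edgeSet, compl_adj]
      exact ⟨fun hab => h.1 (Subtype.ext hab), h.2⟩
  exact fun e he f hf => (sym2Val S).injective (hG (key e he) (key f hf))

/-- A bound for the total weight of the proper nonempty vertex sets of a graph on `n` vertices
missing at most one edge, an edge having weight at most `r`. -/
def cutSum (r : ℝ) (n : ℕ) : ℝ :=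
  ∑ m ∈ range (n + 1), n.choose m • if 0 < m ∧ m < n then r ^ (m * (n - m) - 1) else 0

lemma cutSum_nonneg {r : ℝ} (hr : 0 ≤ r) (n : ℕ) : 0 ≤ cutSum r n := by
  refine Finset.sum_nonneg fun m _ => nsmul_nonneg ?_ _
  split_ifs <;> positivity

lemma abs_relPoly_sub_one_le {V : Type} [Fintype V] [Nonempty V] {G : SimpleGraph V}
    (hG : Gᶜ.edgeSet.Subsingleton) {q r M : ℝ} (hq : |q| ≤ r) (hr : r ≤ 1) (hM : 0 ≤ M)
    (hind : ∀ S : Finset V, S ≠ univ → |relPoly (G.induce (S : Set V)) q| ≤ M) :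
    |relPoly G q - 1| ≤ M * cutSum r (Fintype.card V) := by
  classical
  have hr0 : 0 ≤ r := (abs_nonneg q).trans hq
  obtain ⟨v⟩ := id ‹Nonempty V›
  have hsum := sum_relPoly_induce_eq_one G v q
  rw [← Finset.add_sum_erase _ _ (show univ ∈ univ.filter fun S : Finset V => v ∈ S by simp),
    coe_univ, relPoly_induce_univ] at hsum
  have heq : relPoly G q - 1 = -∑ S ∈ (univ.filter fun S : Finset V => v ∈ S).erase univ,
      relPoly (G.induce (S : Set V)) q * q ^ (edgeBoundary G (S : Set V)).card := by
    linarith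
  rw [heq, abs_neg]
  refine (Finset.abs_sum_le_sum_abs _ _).trans ?_
  set n := Fintype.card V with hn
  let g : ℕ → ℝ := fun m => if 0 < m ∧ m < n then r ^ (m * (n - m) - 1) else 0
  have hg : ∀ m, 0 ≤ g m := by
    intro m
    simp only [g]
    split_ifs <;> positivity
  calc ∑ S ∈ (univ.filter fun S : Finset V => v ∈ S).erase univ,
        |relPoly (G.induce (S : Set V)) q * q ^ (edgeBoundary G (S : Set V)).card|
      ≤ ∑ S ∈ (univ.filter fun S : Finset V => v ∈ S).erase univ, M * g S.card := by
        refine Finset.sum_le_sum fun S hS => ?_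
        rw [mem_erase, mem_filter] at hS
        obtain ⟨hSu, -, hvS⟩ := hS
        have hpos : 0 < S.card := card_pos.2 ⟨v, hvS⟩
        have hlt : S.card < n := (card_lt_iff_ne_univ S).2 hSu
        have hb := card_mul_card_compl_le hG S
        rw [← hn] at hb
        rw [abs_mul, abs_pow]
        simp only [g, if_pos (And.intro hpos hlt)]
        refine mul_le_mul (hind S hSu) ?_ (by positivity) hM
        calc |q| ^ (edgeBoundary G (S : Set V)).card
            ≤ r ^ (edgeBoundary G (S : Set V)).card := by gcongr
          _ ≤ r ^ (S.card * (n - S.card) - 1) :=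
            pow_le_pow_of_le_one hr0 hr (by omega)
    _ ≤ ∑ S ∈ (univ : Finset V).powerset, M * g S.card := by
        refine Finset.sum_le_sum_of_subset_of_nonneg (fun S _ => by simp) fun S _ _ => ?_
        exact mul_nonneg hM (hg _)
    _ = M * cutSum r n := by
        rw [← Finset.mul_sum, Finset.sum_powerset_apply_card, card_univ]
        rfl

lemma choose_mul_pow_le {ρ : ℝ} (hρ0 : 0 < ρ) (hρ1 : ρ ≤ 1) {n m : ℕ} (hm : 0 < m) (hmn : m < n)
    (hn : (n : ℝ) * ρ ^ n ≤ 1) :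
    (n.choose m : ℝ) * ρ ^ (2 * (m * (n - m))) ≤ n * ρ ^ n := by
  have key : ∀ k, 0 < k → 2 * k ≤ n →
      (n.choose k : ℝ) * ρ ^ (2 * (k * (n - k))) ≤ n * ρ ^ n := by
    intro k hk hkn
    have hexp : n * k ≤ 2 * (k * (n - k)) := by
      obtain ⟨d, rfl⟩ := Nat.exists_eq_add_of_le hkn
      rw [show 2 * k + d - k = k + d by omega]
      nlinarith
    calc (n.choose k : ℝ) * ρ ^ (2 * (k * (n - k)))
        ≤ (n : ℝ) ^ k * ρ ^ (n * k) := by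
          gcongr ?_ * ?_
          · exact_mod_cast Nat.choose_le_pow n k
          · exact pow_le_pow_of_le_one hρ0.le hρ1 hexp
      _ = (n * ρ ^ n) ^ k := by rw [mul_pow, pow_mul]
      _ ≤ n * ρ ^ n := pow_le_of_le_one (by positivity) hn hk.ne'
  rcases le_total (2 * m) n with h | h
  · exact key m hm h
  · have := key (n - m) (by omega) (by omega)
    rwa [Nat.choose_symm hmn.le, Nat.sub_sub_self hmn.le, mul_comm (n - m) m] at this

lemma tendsto_cutSum {ρ : ℝ} (hρ0 : 0 < ρ) (hρ1 : ρ < 1) :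
    Filter.Tendsto (cutSum (ρ ^ 2)) Filter.atTop (nhds 0) := by
  have habs : |ρ| < 1 := by rwa [abs_of_pos hρ0]
  have h1 := tendsto_pow_const_mul_const_pow_of_abs_lt_one 1 habs
  have h2 := tendsto_pow_const_mul_const_pow_of_abs_lt_one 2 habs
  have hlim : Filter.Tendsto (fun n : ℕ => ((n : ℝ) + 1) * (n * ρ ^ n / ρ ^ 2)) Filter.atTop
      (nhds 0) := by
    have := (h2.add h1).div_const (ρ ^ 2)
    rw [add_zero, zero_div] at this
    refine this.congr fun n => ?_
    ring
  refine squeeze_zero' (Filter.Eventually.of_forall fun n => cutSum_nonneg (by positivity) n) ?_ hlim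
  filter_upwards [h1.eventually_le_const one_pos] with n hn
  rw [pow_one] at hn
  have hterm : ∀ m ∈ range (n + 1),
      (n.choose m • if 0 < m ∧ m < n then (ρ ^ 2) ^ (m * (n - m) - 1) else 0) ≤
        n * ρ ^ n / ρ ^ 2 := by
    intro m _
    split_ifs with h
    · rw [le_div_iff₀ (by positivity), nsmul_eq_mul, mul_assoc, ← pow_succ,
        Nat.sub_add_cancel (Nat.mul_pos h.1 (Nat.sub_pos_of_lt h.2)), ← pow_mul]
      exact choose_mul_pow_le hρ0 hρ1.le h.1 h.2 hn
    · rw [smul_zero]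
      positivity
  calc cutSum (ρ ^ 2) n ≤ (range (n + 1)).card • (n * ρ ^ n / ρ ^ 2) :=
        Finset.sum_le_card_nsmul _ _ _ hterm
    _ = ((n : ℝ) + 1) * (n * ρ ^ n / ρ ^ 2) := by
        rw [card_range, nsmul_eq_mul]
        push_cast
        rfl

lemma abs_relPoly_le_three_pow {V : Type} [Fintype V] (G : SimpleGraph V) {q : ℝ} (hq : |q| ≤ 1) :
    |relPoly G q| ≤ 3 ^ (Fintype.card V + 1) ^ 2 := by
  classical
  have hE : (edgeFin G).card ≤ (Fintype.card V + 1) ^ 2 :=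
    calc (edgeFin G).card ≤ Fintype.card (Sym2 V) := card_le_univ _
      _ = (Fintype.card V + 1).choose 2 := Sym2.card
      _ ≤ (Fintype.card V + 1) ^ 2 := Nat.choose_le_pow _ _
  have h1q : |1 - q| ≤ 2 := by
    rw [abs_le] at hq ⊢
    constructor <;> linarith [hq.1, hq.2]
  calc |relPoly G q|
      ≤ ∑ A ∈ (edgeFin G).powerset, |1 - q| ^ A.card * |q| ^ ((edgeFin G).card - A.card) := by
        rw [relPoly]
        refine (Finset.abs_sum_le_sum_abs _ _).trans (Finset.sum_le_sum fun A _ => ?_)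
        split_ifs
        · rw [abs_mul, abs_pow, abs_pow]
        · rw [abs_zero]
          positivity
    _ = (|1 - q| + |q|) ^ (edgeFin G).card := Finset.sum_pow_mul_eq_add_pow _ _ _
    _ ≤ 3 ^ (edgeFin G).card := by
        gcongr
        linarith
    _ ≤ 3 ^ (Fintype.card V + 1) ^ 2 := pow_le_pow_right₀ (by norm_num) hE

/-- Reliability polynomials of complete graphs missing at most one edge are uniformly bounded
on compact subsets of the open unit disc. -/
lemma exists_abs_relPoly_le {ρ : ℝ} (hρ0 : 0 < ρ) (hρ1 : ρ < 1) :
    ∃ M : ℝ, 0 ≤ M ∧ ∀ (V : Type) [Fintype V] (G : SimpleGraph V) (q : ℝ),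
      Gᶜ.edgeSet.Subsingleton → |q| ≤ ρ ^ 2 → |relPoly G q| ≤ M := by
  classical
  have hρ2 : ρ ^ 2 ≤ 1 := pow_le_one₀ hρ0.le hρ1.le
  obtain ⟨N, hN⟩ := Filter.eventually_atTop.1
    ((tendsto_cutSum hρ0 hρ1).eventually_le_const (show (0 : ℝ) < 1 / 2 by norm_num))
  set M : ℝ := max 2 (3 ^ (N + 1) ^ 2) with hM
  have hM2 : 2 ≤ M := le_max_left _ _
  refine ⟨M, by linarith, ?_⟩
  have main : ∀ (n : ℕ) (V : Type) [Fintype V] (G : SimpleGraph V) (q : ℝ),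
      Fintype.card V = n → Gᶜ.edgeSet.Subsingleton → |q| ≤ ρ ^ 2 → |relPoly G q| ≤ M := by
    intro n
    induction n using Nat.strong_induction_on with
    | _ n ih =>
      intro V _ G q hn hG hq
      rcases le_or_gt n N with hnN | hnN
      · refine (abs_relPoly_le_three_pow G (hq.trans hρ2)).trans (le_trans ?_ (le_max_right _ _))
        refine pow_le_pow_right₀ (by norm_num) ?_
        gcongr
        omega
      · have : Nonempty V := Fintype.card_pos_iff.1 (by omega)
        have hle := abs_relPoly_sub_one_le hG hq hρ2 (show 0 ≤ M by linarith) fun S hS =>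
          ih S.card (hn ▸ (card_lt_iff_ne_univ S).2 hS) (S : Set V) (G.induce (S : Set V)) q
            (by simp) (compl_induce_edgeSet_subsingleton hG _) hq
        have hcut := hN n hnN.le
        rw [hn] at hle
        have h3 : M * cutSum (ρ ^ 2) n ≤ M * (1 / 2) := by gcongr
        have h4 := abs_le.1 (hle.trans h3)
        rw [abs_le]
        constructor <;> linarith [h4.1, h4.2]
  exact fun V _ G q => main _ V G q rfl

lemma compl_Hgraph_edgeSet_subsingleton (n : ℕ) : (Hgraph n)ᶜ.edgeSet.Subsingleton := by
  have key : ∀ e ∈ (Hgraph n)ᶜ.edgeSet, ∃ _h : 2 ≤ n, e = s(⟨0, by omega⟩, ⟨1, by omega⟩) := by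
    intro e
    induction e using Sym2.ind with
    | _ a b =>
      intro h
      rw [mem_edgeSet, compl_adj, Hgraph, deleteEdges_adj, top_adj] at h
      by_contra hne
      exact h.2 ⟨h.1, hne⟩
  intro e he f hf
  obtain ⟨_, rfl⟩ := key e he
  obtain ⟨_, rfl⟩ := key f hf
  rfl

lemma exists_abs_le_sq {K : Set ℝ} (hKc : IsCompact K) (hK : K ⊆ Set.Ioo (-1 : ℝ) 0) :
    ∃ ρ : ℝ, 0 < ρ ∧ ρ < 1 ∧ ∀ q ∈ K, |q| ≤ ρ ^ 2 := by
  rcases K.eq_empty_or_nonempty with rfl | hne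
  · exact ⟨1 / 2, by norm_num, by norm_num, by simp⟩
  · obtain ⟨x, hx, hmax⟩ := hKc.exists_isMaxOn hne continuous_abs.continuousOn
    have hx' := hK hx
    have habs : |x| = -x := abs_of_neg hx'.2
    refine ⟨√|x|, Real.sqrt_pos.2 (by linarith [hx'.2]), ?_, fun q hq => ?_⟩
    · rw [Real.sqrt_lt' one_pos]
      linarith [hx'.1]
    · rw [Real.sq_sqrt (abs_nonneg x)]
      exact hmax hq

open Filter in
/-- `R_n → 1` uniformly on any compact `K ⊂ (-1, 0)`. -/
theorem rfun_tendsto_one (K : Set ℝ) (hKc : IsCompact K) (hK : K ⊆ Set.Ioo (-1 : ℝ) 0) :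
    Tendsto (fun n : ℕ => ⨆ q ∈ K, |Rfun n q - 1|) atTop (nhds 0) := by
  obtain ⟨ρ, hρ0, hρ1, hρK⟩ := exists_abs_le_sq hKc hK
  obtain ⟨M, hM, hbound⟩ := exists_abs_relPoly_le hρ0 hρ1
  have hlim := (tendsto_cutSum hρ0 hρ1).const_mul M
  rw [mul_zero] at hlim
  refine squeeze_zero' (Eventually.of_forall fun n => ?_) ?_ hlim
  · exact Real.iSup_nonneg fun q => Real.iSup_nonneg fun _ => abs_nonneg _
  · filter_upwards [eventually_ge_atTop 1] with n hn
    have : Nonempty (Fin n) := ⟨⟨0, hn⟩⟩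
    have hnonneg : 0 ≤ M * cutSum (ρ ^ 2) n := mul_nonneg hM (cutSum_nonneg (by positivity) n)
    refine Real.iSup_le (fun q => Real.iSup_le (fun hq => ?_) hnonneg) hnonneg
    have h := abs_relPoly_sub_one_le (compl_Hgraph_edgeSet_subsingleton n) (hρK q hq)
      (pow_le_one₀ hρ0.le hρ1.le) hM fun S _ => hbound _ _ q
        (compl_induce_edgeSet_subsingleton (compl_Hgraph_edgeSet_subsingleton n) _) (hρK q hq)
    rwa [Fintype.card_fin] at h

end
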